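/- If X and Y are two independent points uniformly distributed in a disk of radius R, then the expected distance E[‖X - Y‖] = 128R/(45π). -/

import Mathlib

open MeasureTheory ProbabilityTheory Real

lemma aux_radial (n : ℕ) (a : ℝ) :
    ∫⁻ r in Set.Ioi (0:ℝ), (Set.Iic a).indicator (fun r => ENNReal.ofReal (r^n)) r
      = ENNReal.ofReal ((max a 0)^(n+1)/(n+1)) := by
  rw [setLIntegral_indicator measurableSet_Iic]
  have h : Set.Iic a ∩ Set.Ioi 0 = Set.Ioc 0 (max a 0) := by
    ext r; simp only [Set.mem_inter_iff, Set.mem_Iic, Set.mem_Ioi, Set.mem_Ioc, le_max_iff]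
    constructor
    · rintro ⟨h1, h2⟩; exact ⟨h2, Or.inl h1⟩
    · rintro ⟨h1, h2⟩; exact ⟨h2.resolve_right (not_le.mpr h1), h1⟩
  rw [h, ← ofReal_integral_eq_lintegral_ofReal]
  · rw [← intervalIntegral.integral_of_le (le_max_right _ _), integral_pow]; simp
  · exact (intervalIntegral.intervalIntegrable_pow n).1
  · filter_upwards [ae_restrict_mem measurableSet_Ioc] with r hr
    exact pow_nonneg hr.1.le n

lemma aux_polar (f : ℂ → ENNReal) (hf : Measurable f) :
    ∫⁻ w, f w = ∫⁻ θ in Set.Ioo (-π) π, ∫⁻ r in Set.Ioi (0:ℝ),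
      ENNReal.ofReal r * f (Complex.polarCoord.symm (r, θ)) := by
  rw [← Complex.lintegral_comp_polarCoord_symm, polarCoord_target, Measure.volume_eq_prod,
    setLIntegral_prod_symm]
  · simp only [smul_eq_mul]
  · have : Measurable fun p : ℝ × ℝ => Complex.polarCoord.symm p := by
      simp only [Complex.polarCoord_symm_apply]
      fun_prop
    simp only [smul_eq_mul]
    exact ((ENNReal.measurable_ofReal.comp measurable_fst).mul (hf.comp this)).aemeasurable

lemma aux_disk (s : ℝ) (hs : 0 ≤ s) :
    ∫⁻ w in Metric.closedBall (s:ℂ) s, ‖w‖ₑ = ENNReal.ofReal (32/9 * s^3) := by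
  rw [← lintegral_indicator measurableSet_closedBall, aux_polar _
    (by exact measurable_enorm.indicator measurableSet_closedBall)]
  have h1 : ∀ θ : ℝ, ∫⁻ r in Set.Ioi (0:ℝ),
      ENNReal.ofReal r * (Metric.closedBall (s:ℂ) s).indicator (fun w => ‖w‖ₑ)
        (Complex.polarCoord.symm (r, θ)) = ENNReal.ofReal ((max (2*s*cos θ) 0)^3/3) := by
    intro θ
    have := aux_radial 2 (2*s*cos θ)
    rw [show ((2:ℕ):ℝ) + 1 = 3 by norm_num, show 2 + 1 = 3 from rfl] at this
    rw [← this]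
    refine setLIntegral_congr_fun measurableSet_Ioi fun r hr => ?_
    have hr : 0 < r := hr
    have hn : ‖Complex.polarCoord.symm (r, θ)‖ = r := by
      rw [Complex.norm_polarCoord_symm]; exact abs_of_pos hr
    have hiff : Complex.polarCoord.symm (r, θ) ∈ Metric.closedBall (s:ℂ) s ↔
        r ∈ Set.Iic (2*s*cos θ) := by
      rw [mem_closedBall_iff_norm, Set.mem_Iic, ← sq_le_sq₀ (norm_nonneg _) hs, ← Complex.normSq_eq_norm_sq,
        Complex.polarCoord_symm_apply, Complex.normSq_apply]
      simp [Complex.cos_ofReal_re, Complex.sin_ofReal_re]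
      have : (r * cos θ - s) * (r * cos θ - s) + r * sin θ * (r * sin θ)
        = s^2 + r * (r - 2 * s * cos θ) := by
        linear_combination r^2 * sin_sq_add_cos_sq θ
      rw [this]
      constructor
      · intro h
        by_contra! h'
        nlinarith [mul_pos hr (sub_pos.mpr h')]
      · intro h
        nlinarith [mul_nonneg hr.le (sub_nonneg.mpr h)]
    by_cases h : r ∈ Set.Iic (2*s*cos θ)
    · rw [Set.indicator_of_mem (hiff.mpr h), Set.indicator_of_mem h, ← ofReal_norm, hn, ← ENNReal.ofReal_mul hr.le, sq]
    · rw [Set.indicator_of_notMem (mt hiff.mp h), Set.indicator_of_notMem h, mul_zero]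
  simp_rw [h1]
  have h2 : Set.EqOn (fun θ => ENNReal.ofReal ((max (2*s*cos θ) 0)^3/3))
     ((Set.Ioc (-(π/2)) (π/2)).indicator fun θ => ENNReal.ofReal (8*s^3/3 * cos θ^3)) (Set.Ioo (-π) π) := by
    intro θ hθ
    by_cases h : θ ∈ Set.Ioc (-(π/2)) (π/2)
    · have := cos_nonneg_of_mem_Icc (Set.Ioc_subset_Icc_self h)
      simp only []
      rw [Set.indicator_of_mem h, max_eq_left (by positivity)]
      congr 1; ring
    · have : cos θ ≤ 0 := by
        rw [Set.mem_Ioc, not_and_or, not_lt, not_le] at h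
        rcases h with h | h
        · rw [← cos_neg]; exact cos_nonpos_of_pi_div_two_le_of_le (by linarith) (by linarith [hθ.1, pi_pos])
        · exact cos_nonpos_of_pi_div_two_le_of_le h.le (by linarith [hθ.2, pi_pos])
      simp only []
      rw [Set.indicator_of_notMem h, max_eq_right (by nlinarith)]; simp
  have h3 : Set.Ioc (-(π/2)) (π/2) ∩ Set.Ioo (-π) π = Set.Ioc (-(π/2)) (π/2) :=
    Set.inter_eq_left.mpr (fun x hx => ⟨by linarith [hx.1, pi_pos], by linarith [hx.2, pi_pos]⟩)
  rw [setLIntegral_congr_fun measurableSet_Ioo h2, setLIntegral_indicator measurableSet_Ioc,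
    h3,
    ← ofReal_integral_eq_lintegral_ofReal]
  · rw [← intervalIntegral.integral_of_le (by linarith [pi_pos]), intervalIntegral.integral_const_mul,
      integral_cos_pow_three]
    simp
    congr 1; ring
  · exact (Continuous.intervalIntegrable (by fun_prop) _ _).1
  · filter_upwards [ae_restrict_mem measurableSet_Ioc] with θ hr
    have := cos_nonneg_of_mem_Icc (Set.Ioc_subset_Icc_self hr)
    show 0 ≤ _
    positivity

lemma aux_J (x : ℂ) :
    ∫⁻ y in Metric.closedBall (0:ℂ) ‖x‖, ‖x - y‖ₑ = ENNReal.ofReal (32/9 * ‖x‖^3) := by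
  obtain ⟨u, hu⟩ : ∃ u : Circle, x = u * (‖x‖ : ℂ) := by
    refine ⟨Circle.exp x.arg, ?_⟩
    rw [Circle.coe_exp, mul_comm, Complex.norm_mul_exp_arg_mul_I]
  rw [← aux_disk _ (norm_nonneg x), ← lintegral_indicator measurableSet_closedBall,
    ← lintegral_indicator measurableSet_closedBall,
    ← lintegral_sub_left_eq_self _ x,
    ← (rotation u).measurePreserving.lintegral_comp_emb (rotation u).toHomeomorph.measurableEmbedding]
  congr 1 with w
  have hue : ‖(u:ℂ)‖ₑ = 1 := by rw [← ofReal_norm, Circle.norm_coe]; simp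
  have : ‖x - u * w‖ = ‖w - ‖x‖‖ := by
    conv_lhs => rw [hu, ← mul_sub, norm_mul, Circle.norm_coe, one_mul, norm_sub_rev]
  simp [Set.indicator, dist_eq_norm, rotation_apply, this, hue]

lemma aux_outer (R : ℝ) (hR : 0 < R) :
    ∫⁻ x in Metric.closedBall (0:ℂ) R, ENNReal.ofReal (32/9 * ‖x‖^3)
      = ENNReal.ofReal (64 * π / 45 * R^5) := by
  rw [← lintegral_indicator measurableSet_closedBall, aux_polar _
    (by refine Measurable.indicator (by fun_prop) measurableSet_closedBall)]
  have h1 : ∀ θ : ℝ, ∫⁻ r in Set.Ioi (0:ℝ),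
      ENNReal.ofReal r * (Metric.closedBall (0:ℂ) R).indicator (fun x => ENNReal.ofReal (32/9 * ‖x‖^3))
        (Complex.polarCoord.symm (r, θ)) = ENNReal.ofReal (32/9) * ENNReal.ofReal (R^5/5) := by
    intro θ
    have := aux_radial 4 R
    rw [show ((4:ℕ):ℝ) + 1 = 5 by norm_num, show 4 + 1 = 5 from rfl, max_eq_left hR.le] at this
    rw [← this, ← lintegral_const_mul _ (Measurable.indicator (by fun_prop) measurableSet_Iic)]
    refine setLIntegral_congr_fun measurableSet_Ioi fun r hr => ?_
    have hr : 0 < r := hr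
    have hn : ‖Complex.polarCoord.symm (r, θ)‖ = r := by
      rw [Complex.norm_polarCoord_symm]; exact abs_of_pos hr
    simp only [Set.indicator, mem_closedBall_zero_iff, hn, Set.mem_Iic]
    split_ifs
    · rw [← ENNReal.ofReal_mul hr.le, ← ENNReal.ofReal_mul (by norm_num)]
      congr 1; ring
    · simp
  simp_rw [h1]
  rw [setLIntegral_const, Real.volume_Ioo, ← ENNReal.ofReal_mul (by norm_num), ← ENNReal.ofReal_mul (by positivity)]
  congr 1; ring

lemma aux_main (R : ℝ) (hR : 0 < R) :
    ∫⁻ x in Metric.closedBall (0:ℂ) R, ∫⁻ y in Metric.closedBall (0:ℂ) R, ‖x - y‖ₑ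
      = ENNReal.ofReal (128 * π / 45 * R^5) := by
  set B := Metric.closedBall (0:ℂ) R
  have hm : Measurable fun p : ℂ × ℂ => ‖p.1 - p.2‖ₑ := by fun_prop
  have h1 : ∀ x ∈ B, ∫⁻ y in B, ‖x - y‖ₑ = ENNReal.ofReal (32/9 * ‖x‖^3) +
      ∫⁻ y in B, {p : ℂ × ℂ | ‖p.1‖ < ‖p.2‖}.indicator (fun p => ‖p.1 - p.2‖ₑ) (x, y) := by
    intro x hx
    have hx : ‖x‖ ≤ R := by simpa [B] using hx
    rw [← aux_J, ← lintegral_inter_add_sdiff (μ := volume) _ B (B := Metric.closedBall (0:ℂ) ‖x‖) measurableSet_closedBall,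
      Set.inter_eq_right.mpr (Metric.closedBall_subset_closedBall hx)]
    congr 1
    rw [← lintegral_indicator (measurableSet_closedBall.diff measurableSet_closedBall),
      ← lintegral_indicator measurableSet_closedBall]
    congr 1 with y
    by_cases h : ‖x‖ < ‖y‖ <;> simp [Set.indicator, h]
  have hlt : MeasurableSet {p : ℂ × ℂ | ‖p.1‖ < ‖p.2‖} :=
    measurableSet_lt (by fun_prop) (by fun_prop)
  have h2 : ∀ y ∈ B, ∫⁻ x in B, {p : ℂ × ℂ | ‖p.1‖ < ‖p.2‖}.indicator (fun p => ‖p.1 - p.2‖ₑ) (x, y)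
      = ENNReal.ofReal (32/9 * ‖y‖^3) := by
    intro y hy
    have hy : ‖y‖ ≤ R := by simpa [B] using hy
    rw [← aux_J]
    have hae : (Metric.closedBall (0:ℂ) ‖y‖ : Set ℂ) =ᵐ[volume] Metric.ball (0:ℂ) ‖y‖ := by
      rw [← Metric.ball_union_sphere]
      exact union_ae_eq_left_of_ae_eq_empty (ae_eq_empty.mpr (Measure.addHaar_sphere _ _ _))
    rw [setLIntegral_congr hae, ← lintegral_indicator measurableSet_ball,
      ← lintegral_indicator measurableSet_closedBall]
    congr 1 with x
    by_cases h : ‖x‖ < ‖y‖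
    · simp [Set.indicator, h, (h.le.trans hy), enorm_sub_rev]
    · simp [Set.indicator, h]
  rw [setLIntegral_congr_fun measurableSet_closedBall h1, lintegral_add_left (by fun_prop),
    lintegral_lintegral_swap (f := fun x y => {p : ℂ × ℂ | ‖p.1‖ < ‖p.2‖}.indicator (fun p => ‖p.1 - p.2‖ₑ) (x, y))
      (hm.indicator hlt).aemeasurable,
    setLIntegral_congr_fun measurableSet_closedBall h2, aux_outer R hR, ← ENNReal.ofReal_add (by positivity) (by positivity)]
  congr 1; ring

lemma aux_E (R : ℝ) (hR : 0 < R) :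
    ∫⁻ x in Metric.closedBall (0 : EuclideanSpace ℝ (Fin 2)) R,
      ∫⁻ y in Metric.closedBall (0 : EuclideanSpace ℝ (Fin 2)) R, edist x y
      = ENNReal.ofReal (128 * π / 45 * R^5) := by
  let e := Complex.orthonormalBasisOneI.repr
  have key : ∀ f : EuclideanSpace ℝ (Fin 2) → ENNReal,
      ∫⁻ x in Metric.closedBall (0 : EuclideanSpace ℝ (Fin 2)) R, f x
      = ∫⁻ z in Metric.closedBall (0 : ℂ) R, f (e z) := by
    intro f
    rw [← e.measurePreserving.setLIntegral_comp_preimage_emb e.toHomeomorph.measurableEmbedding]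
    congr 2
    ext z; simp
  simp only [key]
  rw [← aux_main R hR]
  simp only [e.isometry.edist_eq, edist_eq_enorm_sub]

lemma aux_vol (R : ℝ) (hR : 0 < R) :
    volume (Metric.closedBall (0 : EuclideanSpace ℝ (Fin 2)) R) = ENNReal.ofReal (π * R^2) := by
  rw [EuclideanSpace.volume_closedBall_fin_two, ENNReal.ofReal_mul pi_pos.le,
    ENNReal.ofReal_pow hR.le, mul_comm]

lemma aux_fin {Ω E : Type*} [MeasurableSpace Ω] (μ : Measure Ω) [PseudoMetricSpace E]
    (X Y : Ω → E) (c : ℝ) (hc : 0 ≤ c) (hm : AEMeasurable (fun ω => edist (X ω) (Y ω)) μ)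
    (hmain : ∫⁻ ω, edist (X ω) (Y ω) ∂μ = ENNReal.ofReal c) :
    ∫ ω, dist (X ω) (Y ω) ∂μ = c := by
  have hlt : ∀ᵐ ω ∂μ, edist (X ω) (Y ω) < ⊤ :=
    Filter.Eventually.of_forall fun ω => edist_lt_top _ _
  have hfin := integral_toReal hm hlt
  rw [hmain, ENNReal.toReal_ofReal hc] at hfin
  rw [← hfin]
  refine integral_congr_ae (Filter.Eventually.of_forall fun ω => ?_)
  exact dist_edist (X ω) (Y ω)

theorem mean_distance_two_uniform_points_disk
    {Ω : Type*} [MeasurableSpace Ω] (μ : Measure Ω) [IsProbabilityMeasure μ]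
    (R : ℝ) (hR : 0 < R)
    (X Y : Ω → EuclideanSpace ℝ (Fin 2))
    (hXY : IndepFun X Y μ)
    (hX : Measure.map X μ =
      (volume (Metric.closedBall (0 : EuclideanSpace ℝ (Fin 2)) R))⁻¹ •
        volume.restrict (Metric.closedBall (0 : EuclideanSpace ℝ (Fin 2)) R))
    (hY : Measure.map Y μ =
      (volume (Metric.closedBall (0 : EuclideanSpace ℝ (Fin 2)) R))⁻¹ •
        volume.restrict (Metric.closedBall (0 : EuclideanSpace ℝ (Fin 2)) R)) :
    ∫ ω, dist (X ω) (Y ω) ∂μ = 128 * R / (45 * π) := by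
  have hv := aux_vol R hR
  have hp : 0 < π * R^2 := by positivity
  have hne : (volume (Metric.closedBall (0 : EuclideanSpace ℝ (Fin 2)) R))⁻¹ •
        volume.restrict (Metric.closedBall (0 : EuclideanSpace ℝ (Fin 2)) R) ≠ 0 := by
    intro h
    have := congrArg (fun m => m Set.univ) h
    simp [hv] at this
    exact absurd this (not_le.mpr hp)
  have hXm : AEMeasurable X μ := by
    by_contra h
    exact hne (hX.symm.trans (Measure.map_of_not_aemeasurable h))
  have hYm : AEMeasurable Y μ := by
    by_contra h
    exact hne (hY.symm.trans (Measure.map_of_not_aemeasurable h))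
  have hd : Measurable fun p : EuclideanSpace ℝ (Fin 2) × EuclideanSpace ℝ (Fin 2) =>
    edist p.1 p.2 := by fun_prop
  have hmain : ∫⁻ ω, edist (X ω) (Y ω) ∂μ = ENNReal.ofReal (128 * R / (45 * π)) := by
    have := lintegral_map' hd.aemeasurable (hXm.prodMk hYm)
    simp only at this
    rw [← this, hXY.map_prod_eq_prod_map_map hXm hYm]
    have := Measure.isProbabilityMeasure_map hYm
    rw [lintegral_prod _ hd.aemeasurable]
    simp only [hX, hY, lintegral_smul_measure, smul_eq_mul]
    rw [lintegral_const_mul' _ _ (by simp [hv, hp]), aux_E R hR, hv,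
      ← ENNReal.ofReal_inv_of_pos hp, ← ENNReal.ofReal_mul (by positivity), ← ENNReal.ofReal_mul (by positivity)]
    congr 1
    field_simp
  have hpos : 0 ≤ 128 * R / (45 * π) := by positivity
  have hm : AEMeasurable (fun ω => edist (X ω) (Y ω)) μ :=
    hXm.edist hYm
  exact aux_fin μ X Y _ hpos hm hmain
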